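/- There is no witness Gabriel drawing of K_{2,2,2,2} in which all vertices of the same color are consecutive on the convex hull: there do not exist a witness Gabriel drawing (P, W, c) of the complete 4-partite graph K_{2,2,2,2} (c : P → Fin 4 with every color class of size exactly 2, P ∪ W in general position) and a bijection q : Fin 8 → P with q(0), …, q(7) in counterclockwise convex position such that c(q(0)) = c(q(1)), c(q(2)) = c(q(3)), c(q(4)) = c(q(5)), and c(q(6)) = c(q(7)). -/

import Mathlib

open scoped RealInnerProductSpace

noncomputable section

/-- The Euclidean plane. -/
abbrev Pt := EuclideanSpace ℝ (Fin 2)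

/-- The closed disk with diameter `ab`. -/
def diskD (a b : Pt) : Set Pt := Metric.closedBall (midpoint ℝ a b) (dist a b / 2)

/-- `a` and `b` are adjacent in the witness Gabriel graph with witness set `W`. -/
def gabrielEdge (W : Set Pt) (a b : Pt) : Prop := (diskD a b \ {a, b}) ∩ W = ∅

/-- General position: no three points collinear, no four points concyclic. -/
def GenPos (S : Set Pt) : Prop :=
  (∀ a ∈ S, ∀ b ∈ S, ∀ c ∈ S, a ≠ b → a ≠ c → b ≠ c → ¬ Collinear ℝ ({a, b, c} : Set Pt)) ∧
  (∀ a ∈ S, ∀ b ∈ S, ∀ c ∈ S, ∀ d ∈ S, a ≠ b → a ≠ c → a ≠ d → b ≠ c → b ≠ d → c ≠ d →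
    ¬ EuclideanGeometry.Cospherical ({a, b, c, d} : Set Pt))

/-- Planar determinant `u₁v₂ − u₂v₁`. -/
def det2 (u v : Pt) : ℝ := u 0 * v 1 - u 1 * v 0

/-- Counterclockwise convex position. -/
def CCWConvexPos {m : ℕ} (q : Fin m → Pt) : Prop :=
  ∀ i j k : Fin m, i < j → j < k → 0 < det2 (q j - q i) (q k - q i)

/-- Cyclic successor in `Fin m`. -/
def cyclicSucc {m : ℕ} (hm : 0 < m) (i : Fin m) : Fin m :=
  ⟨((i : ℕ) + 1) % m, Nat.mod_lt _ hm⟩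

def dt (w x y : Pt) : ℝ := (x 0 - w 0) * (y 0 - w 0) + (x 1 - w 1) * (y 1 - w 1)
def dd (w x y : Pt) : ℝ := (x 0 - w 0) * (y 1 - w 1) - (x 1 - w 1) * (y 0 - w 0)

theorem dt_comm (w x y : Pt) : dt w x y = dt w y x := by unfold dt; ring
theorem dd_anti (w x y : Pt) : dd w x y = - dd w y x := by unfold dd; ring

theorem dt_self_nonneg (w x : Pt) : 0 ≤ dt w x x := by
  unfold dt; nlinarith [sq_nonneg (x 0 - w 0), sq_nonneg (x 1 - w 1)]

theorem dt_self_pos {w x y : Pt} (h : 0 < dt w x y) : 0 < dt w x x := by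
  have h1 : dt w x y ^ 2 + dd w x y ^ 2 = dt w x x * dt w y y := by unfold dt dd; ring
  have h2 := dt_self_nonneg w x
  rcases h2.lt_or_eq with h3 | h3
  · exact h3
  · rw [← h3] at h1
    nlinarith [sq_nonneg (dd w x y), pow_pos h 2]

theorem cone1 {w a b x : Pt} (h : dt w a b ≤ 0) (ha : 0 < dt w a x) (hb : 0 < dt w b x) :
    0 < dd w a x * dd w a b ∧ 0 < dd w x b * dd w a b := by
  have e1 : dd w a x * dd w a b = dt w a a * dt w b x - dt w a x * dt w a b := by
    unfold dt dd; ring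
  have e2 : dd w x b * dd w a b = dt w b b * dt w a x - dt w b x * dt w a b := by
    unfold dt dd; ring
  have pa := dt_self_pos ha
  have pb := dt_self_pos hb
  constructor
  · rw [e1]; nlinarith [mul_pos pa hb, mul_nonneg ha.le (neg_nonneg.2 h)]
  · rw [e2]; nlinarith [mul_pos pb ha, mul_nonneg hb.le (neg_nonneg.2 h)]

theorem wedge {w a b x y : Pt} (h : dt w a b ≤ 0) (ha : 0 < dt w a x) (hb : 0 < dt w b x)
    (ha' : 0 < dt w a y) (hb' : 0 < dt w b y) : 0 < dt w x y := by
  obtain ⟨h1, h2⟩ := cone1 h ha hb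
  have e : dd w a b ^ 2 * dt w x y
      = (dd w x b * dd w a b) * dt w a y + (dd w a x * dd w a b) * dt w b y := by
    unfold dt dd; ring
  have h3 : 0 < dd w a b ^ 2 * dt w x y := by rw [e]; positivity
  by_contra hn
  push Not at hn
  nlinarith [mul_nonneg (sq_nonneg (dd w a b)) (neg_nonneg.2 hn)]

theorem shrink {w a b x y : Pt} (h : dt w a b ≤ 0) (hD : 0 < dd w a b)
    (hax : 0 < dt w a x) (hbx : 0 < dt w b x) (hay : 0 < dt w a y) (hby : 0 < dt w b y)
    (ex : 0 < dd a b x) (ey : 0 < dd a b y) : dt x y y < dt a b b := by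
  obtain ⟨h1, h2⟩ := cone1 h hax hbx
  obtain ⟨h3, h4⟩ := cone1 h hay hby
  have pT1 := pos_of_mul_pos_left h1 hD.le
  have pS1 := pos_of_mul_pos_left h2 hD.le
  have pT2 := pos_of_mul_pos_left h3 hD.le
  have pS2 := pos_of_mul_pos_left h4 hD.le
  have ex' : dd a b x = dd w a b - dd w x b - dd w a x := by unfold dd; ring
  have ey' : dd a b y = dd w a b - dd w y b - dd w a y := by unfold dd; ring
  have e : dd w a b ^ 2 * (dt a b b - dt x y y) =
      (dd w a b ^ 2 - (dd w x b - dd w y b) ^ 2) * dt w a a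
      + (dd w a b ^ 2 - (dd w a x - dd w a y) ^ 2) * dt w b b
      - 2 * dt w a b * (dd w a b ^ 2 + (dd w x b - dd w y b) * (dd w a x - dd w a y)) := by
    unfold dt dd; ring
  have pa := dt_self_pos hax
  have pb := dt_self_pos hbx
  generalize dd w a b = D at *
  generalize dd w x b = S1 at *
  generalize dd w y b = S2 at *
  generalize dd w a x = T1 at *
  generalize dd w a y = T2 at *
  have q1 : 0 < D ^ 2 - (S1 - S2) ^ 2 := by nlinarith
  have q2 : 0 < D ^ 2 - (T1 - T2) ^ 2 := by nlinarith
  have q3 : 0 < D ^ 2 + (S1 - S2) * (T1 - T2) := by nlinarith [sq_nonneg (S1 - S2 + (T1 - T2))]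
  have : 0 < D ^ 2 * (dt a b b - dt x y y) := by
    rw [e]
    nlinarith [mul_pos q1 pa, mul_pos q2 pb, mul_nonneg (neg_nonneg.2 h) q3.le]
  have := pos_of_mul_pos_right this (sq_nonneg D)
  linarith

theorem realcore {α1 α2 αb D S T : ℝ} (h1 : 0 < α1) (h2 : 0 < α2) (hD : 0 < D) (hS : 0 < S)
    (hT : 0 < T) (hST : D < S + T) (e : D * αb = S * α1 + T * α2) (k1 : αb + T < α1)
    (k2 : αb < S + α2) : False := by
  have a1 : T * (α2 + D) < (D - S) * α1 := by nlinarith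
  have a2 : S * α1 < S * D + (D - T) * α2 := by nlinarith
  have a0 : 0 < D - S := by
    by_contra hn
    push Not at hn
    nlinarith [mul_pos hT (add_pos h2 hD), mul_nonneg (neg_nonneg.2 hn) h1.le]
  have a3 : α2 + D < α1 := by
    by_contra hn
    push Not at hn
    nlinarith [mul_nonneg a0.le (sub_nonneg.2 hn), mul_pos (sub_pos.2 hST) (add_pos h2 hD)]
  nlinarith [mul_pos hS (sub_pos.2 a3), mul_pos (sub_pos.2 hST) h2]

/-- near witness lemma, left and right -/
theorem nearL {wa wb a1 a2 b : Pt} (h : dt wa a1 a2 ≤ 0) (hD : dd wa a1 a2 < 0)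
    (h1 : 0 < dt wa a1 b) (h2 : 0 < dt wa a2 b) (ed : 0 < dd a1 a2 b)
    (α1 : 0 < dd wa wb a1) (α2 : 0 < dd wa wb a2)
    (k1 : 0 < dd wb a1 b) (k2 : 0 < dd wb a2 b) : False := by
  obtain ⟨c1, c2⟩ := cone1 h h1 h2
  have T1 : dd wa a1 b < 0 := by
    by_contra hn
    push Not at hn
    nlinarith
  have S1 : dd wa b a2 < 0 := by
    by_contra hn
    push Not at hn
    nlinarith
  refine realcore (αb := dd wa wb b) (D := -dd wa a1 a2) (S := - dd wa b a2)
    (T := -dd wa a1 b) α1 α2 (by linarith) (by linarith) (by linarith) ?_ ?_ ?_ ?_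
  · unfold dd at *; linarith
  · unfold dd; ring
  · unfold dd at *; linarith
  · unfold dd at *; linarith

theorem nearR {wa wb a1 a2 b : Pt} (h : dt wa a1 a2 ≤ 0) (hD : dd wa a1 a2 < 0)
    (h1 : 0 < dt wa a1 b) (h2 : 0 < dt wa a2 b) (ed : 0 < dd a1 a2 b)
    (α1 : dd wa wb a1 < 0) (α2 : dd wa wb a2 < 0)
    (k1 : dd wb a1 b < 0) (k2 : dd wb a2 b < 0) : False := by
  obtain ⟨c1, c2⟩ := cone1 h h1 h2
  have T1 : dd wa a1 b < 0 := by
    by_contra hn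
    push Not at hn
    nlinarith
  have S1 : dd wa b a2 < 0 := by
    by_contra hn
    push Not at hn
    nlinarith
  refine realcore (α1 := -dd wa wb a2) (α2 := -dd wa wb a1) (αb := -dd wa wb b)
    (D := -dd wa a1 a2) (S := - dd wa a1 b)
    (T := -dd wa b a2) (by linarith) (by linarith) (by linarith) (by linarith) (by linarith)
    ?_ ?_ ?_ ?_
  · unfold dd at *; linarith
  · unfold dd; ring
  · unfold dd at *; linarith
  · unfold dd at *; linarith

/-- near `a`, both `a`'s on one side: contradiction -/
theorem nearAll {wa wb a1 a2 b1 b2 : Pt} (h : dt wa a1 a2 ≤ 0) (hD : dd wa a1 a2 < 0)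
    (h' : dt wb b1 b2 ≤ 0)
    (h11 : 0 < dt wa a1 b1) (h21 : 0 < dt wa a2 b1) (h12 : 0 < dt wa a1 b2) (h22 : 0 < dt wa a2 b2)
    (g11 : 0 < dt wb b1 a1) (g21 : 0 < dt wb b2 a1) (g12 : 0 < dt wb b1 a2) (g22 : 0 < dt wb b2 a2)
    (ed1 : 0 < dd a1 a2 b1) (ed2 : 0 < dd a1 a2 b2)
    (side : (0 < dd wa wb a1 ∧ 0 < dd wa wb a2) ∨ (dd wa wb a1 < 0 ∧ dd wa wb a2 < 0)) :
    False := by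
  obtain ⟨c1, c2⟩ := cone1 h' g11 g21
  obtain ⟨c3, c4⟩ := cone1 h' g12 g22
  have m1 := dd_anti wb b1 a1
  have m2 := dd_anti wb b1 a2
  have hne : dd wb b1 b2 ≠ 0 := by
    intro h0; rw [h0] at c1; simp at c1
  rcases lt_or_gt_of_ne hne with hb | hb
  · have x1 := neg_of_mul_pos_left c1 hb.le
    have x2 := neg_of_mul_pos_left c2 hb.le
    have x3 := neg_of_mul_pos_left c3 hb.le
    have x4 := neg_of_mul_pos_left c4 hb.le
    rcases side with ⟨s1, s2⟩ | ⟨s1, s2⟩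
    · exact nearL h hD h11 h21 ed1 s1 s2 (by linarith) (by linarith)
    · exact nearR h hD h12 h22 ed2 s1 s2 (by linarith) (by linarith)
  · have x1 := pos_of_mul_pos_left c1 hb.le
    have x2 := pos_of_mul_pos_left c2 hb.le
    have x3 := pos_of_mul_pos_left c3 hb.le
    have x4 := pos_of_mul_pos_left c4 hb.le
    rcases side with ⟨s1, s2⟩ | ⟨s1, s2⟩
    · exact nearL h hD h12 h22 ed2 s1 s2 (by linarith) (by linarith)
    · exact nearR h hD h11 h21 ed1 s1 s2 (by linarith) (by linarith)

theorem sidecone {w v b1 b2 x : Pt} (h : dt w b1 b2 ≤ 0) (h1 : 0 < dt w b1 x)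
    (h2 : 0 < dt w b2 x) :
    (0 < dd v w b1 → 0 < dd v w b2 → 0 < dd v w x) ∧
    (dd v w b1 < 0 → dd v w b2 < 0 → dd v w x < 0) := by
  obtain ⟨c1, c2⟩ := cone1 h h1 h2
  have e : dd w b1 b2 ^ 2 * dd v w x
      = (dd w x b2 * dd w b1 b2) * dd v w b1 + (dd w b1 x * dd w b1 b2) * dd v w b2 := by
    unfold dd; ring
  constructor
  · intro k1 k2
    have : 0 < dd w b1 b2 ^ 2 * dd v w x := by rw [e]; positivity
    exact pos_of_mul_pos_right this (sq_nonneg _)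
  · intro k1 k2
    have : dd w b1 b2 ^ 2 * dd v w x < 0 := by
      rw [e]; nlinarith [mul_pos c2 (neg_pos.2 k1), mul_pos c1 (neg_pos.2 k2)]
    by_contra hn
    push Not at hn
    nlinarith [mul_nonneg (sq_nonneg (dd w b1 b2)) hn]

theorem noSide {wa wb a1 a2 b1 b2 : Pt} (h : dt wa a1 a2 ≤ 0)
    (h' : dt wb b1 b2 ≤ 0)
    (h11 : 0 < dt wa a1 b1) (h21 : 0 < dt wa a2 b1) (h12 : 0 < dt wa a1 b2) (h22 : 0 < dt wa a2 b2)
    (g11 : 0 < dt wb b1 a1) (g21 : 0 < dt wb b2 a1) (g12 : 0 < dt wb b1 a2) (g22 : 0 < dt wb b2 a2)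
    (ed1 : 0 < dd a1 a2 b1) (ed2 : 0 < dd a1 a2 b2)
    (fd1 : 0 < dd b1 b2 a1) (fd2 : 0 < dd b1 b2 a2)
    (side : (0 < dd wa wb b1 ∧ 0 < dd wa wb b2) ∨ (dd wa wb b1 < 0 ∧ dd wa wb b2 < 0)) :
    False := by
  have s1 := sidecone (v := wa) h' g11 g21
  have s2 := sidecone (v := wa) h' g12 g22
  have hne : dd wa a1 a2 ≠ 0 := by
    intro h0; have := (cone1 h h11 h21).1; rw [h0] at this; simp at this
  have hne' : dd wb b1 b2 ≠ 0 := by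
    intro h0; have := (cone1 h' g11 g21).1; rw [h0] at this; simp at this
  rcases lt_or_gt_of_ne hne with ha | ha
  · refine nearAll h ha h' h11 h21 h12 h22 g11 g21 g12 g22 ed1 ed2 ?_
    rcases side with ⟨x, y⟩ | ⟨x, y⟩
    · exact Or.inl ⟨s1.1 x y, s2.1 x y⟩
    · exact Or.inr ⟨s1.2 x y, s2.2 x y⟩
  · rcases lt_or_gt_of_ne hne' with hb | hb
    · refine nearAll h' hb h g11 g21 g12 g22 h11 h21 h12 h22 fd1 fd2 ?_
      have e1 : dd wb wa b1 = - dd wa wb b1 := by unfold dd; ring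
      have e2 : dd wb wa b2 = - dd wa wb b2 := by unfold dd; ring
      rw [e1, e2]
      rcases side with ⟨x, y⟩ | ⟨x, y⟩
      · right; constructor <;> linarith
      · left; constructor <;> linarith
    · have := shrink h ha h11 h21 h12 h22 ed1 ed2
      have := shrink h' hb g11 g21 g12 g22 fd1 fd2
      linarith

theorem inCone {w v b1 b2 z : Pt} (hb : 0 < dt w b1 b2) (hv : dt v b1 b2 ≤ 0)
    (side : ¬ ((0 < dd w v b1 ∧ 0 < dd w v b2) ∨ (dd w v b1 < 0 ∧ dd w v b2 < 0)))
    (h1 : 0 < dt w b1 z) (h2 : 0 < dt w b2 z) : 0 < dt w v z := by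
  have p1 := dt_self_pos h1
  have p2 := dt_self_pos h2
  have hve : 0 < dt w v b1 + dt w v b2 := by
    have e : dt v b1 b2 = dt w b1 b2 - (dt w v b1 + dt w v b2) + dt w v v := by unfold dt; ring
    have := dt_self_nonneg w v
    linarith
  have e1 : dd w v b2 * (dt w b1 b1 + dt w b1 b2) - dd w v b1 * (dt w b1 b2 + dt w b2 b2)
      = dd w b1 b2 * (dt w v b1 + dt w v b2) := by unfold dt dd; ring
  have e2 : dd w v b2 * dt w b1 z - dd w v b1 * dt w b2 z = dd w b1 b2 * dt w v z := by
    unfold dt dd; ring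
  have e3 : dt w b1 b1 * dt w v z = dt w v b1 * dt w b1 z - dd w v b1 * dd w b1 z := by
    unfold dt dd; ring
  have e4 : dt w b2 b2 * dt w v z = dt w v b2 * dt w b2 z - dd w v b2 * dd w b2 z := by
    unfold dt dd; ring
  have q1 : 0 < dt w b1 b1 + dt w b1 b2 := by linarith
  have q2 : 0 < dt w b1 b2 + dt w b2 b2 := by linarith
  by_cases hz : dd w v b1 = 0 ∧ dd w v b2 = 0
  · obtain ⟨z1, z2⟩ := hz
    rw [z1] at e3
    rw [z2] at e4
    by_cases hp : 0 < dt w v b1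
    · have : 0 < dt w b1 b1 * dt w v z := by rw [e3]; nlinarith [mul_pos hp h1]
      exact pos_of_mul_pos_right this p1.le
    · have hp : 0 < dt w v b2 := by linarith
      have : 0 < dt w b2 b2 * dt w v z := by rw [e4]; nlinarith [mul_pos hp h2]
      exact pos_of_mul_pos_right this p2.le
  generalize dd w v b1 = B1 at *
  generalize dd w v b2 = B2 at *
  have cases : (0 ≤ B2 ∧ B1 ≤ 0 ∧ 0 < B2 - B1) ∨ (B2 ≤ 0 ∧ 0 ≤ B1 ∧ B2 - B1 < 0) := by
    by_contra hc
    apply hz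
    grind
  rcases cases with ⟨c1, c2, c3⟩ | ⟨c1, c2, c3⟩
  · have pos : ∀ s t : ℝ, 0 < s → 0 < t → 0 < B2 * s - B1 * t := by
      intro s t hs ht
      rcases c1.lt_or_eq with c | c
      · nlinarith [mul_pos c hs, mul_nonneg (neg_nonneg.2 c2) ht.le]
      · have : 0 < -B1 := by linarith
        nlinarith [mul_pos this ht, mul_nonneg c1 hs.le]
    have r1 := pos _ _ q1 q2
    have r2 := pos _ _ h1 h2
    rw [e1] at r1
    rw [e2] at r2
    exact pos_of_mul_pos_right r2 (pos_of_mul_pos_left r1 hve.le).le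
  · have pos : ∀ s t : ℝ, 0 < s → 0 < t → B2 * s - B1 * t < 0 := by
      intro s t hs ht
      rcases c2.lt_or_eq with c | c
      · nlinarith [mul_pos c ht, mul_nonneg (neg_nonneg.2 c1) hs.le]
      · have : 0 < -B2 := by linarith
        nlinarith [mul_pos this hs, mul_nonneg c2 ht.le]
    have r1 := pos _ _ q1 q2
    have r2 := pos _ _ h1 h2
    rw [e1] at r1
    rw [e2] at r2
    have r3 : dd w b1 b2 < 0 := by
      by_contra hn
      push Not at hn
      nlinarith
    by_contra hn
    push Not at hn
    nlinarith

theorem mid {w : Fin 4 → Pt} (H : ∀ i j k, i ≠ j → i ≠ k → j ≠ k → 0 < dt (w i) (w j) (w k))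
    (a b c d : Fin 4) (hab : a ≠ b) (hac : a ≠ c) (had : a ≠ d) (hbc : b ≠ c) (hbd : b ≠ d)
    (hcd : c ≠ d) (h1 : 0 < dd (w a) (w b) (w c)) (h2 : 0 < dd (w a) (w c) (w d)) : False := by
  have x1 := H a b c hab hac hbc
  have x2 := H a b d hab had hbd
  have x3 := H a c d hac had hcd
  have y1 := H b a c hab.symm hbc hac
  have y2 := H d a c had.symm hcd.symm hac
  have y3 := H c b d hbc.symm hcd hbd
  have z1 := H c a b hac.symm hbc.symm hab
  have z2 := H c a d hac.symm hcd had
  have p := dt_self_pos x1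
  have pc : 0 < dt (w a) (w c) (w c) := dt_self_pos x3
  have e0 : dd (w a) (w b) (w d) * dt (w a) (w b) (w c) =
    dd (w a) (w c) (w d) * dt (w a) (w b) (w b) + dd (w a) (w b) (w c) * dt (w a) (w b) (w d) := by
    unfold dt dd; ring
  have hD : 0 < dd (w a) (w b) (w d) := by
    have : 0 < dd (w a) (w b) (w d) * dt (w a) (w b) (w c) := by rw [e0]; positivity
    exact pos_of_mul_pos_left this x1.le
  have e1 : dd (w a) (w c) (w d) * (dt (w a) (w c) (w c) - dt (w c) (w a) (w b))
      + dd (w a) (w b) (w c) * (dt (w a) (w c) (w c) - dt (w c) (w a) (w d))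
      = dd (w a) (w b) (w d) * dt (w a) (w c) (w c) := by
    unfold dt dd; ring
  have hs : 0 < dd (w a) (w c) (w d) + dd (w a) (w b) (w c) - dd (w a) (w b) (w d) := by
    have : 0 < (dd (w a) (w c) (w d) + dd (w a) (w b) (w c) - dd (w a) (w b) (w d))
        * dt (w a) (w c) (w c) := by
      nlinarith [mul_pos h2 z1, mul_pos h1 z2]
    exact pos_of_mul_pos_left this pc.le
  have e2 : dd (w a) (w c) (w d) * dt (w b) (w a) (w c) + dd (w a) (w b) (w c) * dt (w d) (w a) (w c)
     + (dd (w a) (w c) (w d) + dd (w a) (w b) (w c) - dd (w a) (w b) (w d)) * dt (w a) (w b) (w d)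
     + dd (w a) (w b) (w d) * dt (w c) (w b) (w d) = 0 := by
    unfold dt dd; ring
  have := mul_pos h2 y1
  have := mul_pos h1 y2
  have := mul_pos hs x2
  have := mul_pos hD y3
  linarith

theorem four {w : Fin 4 → Pt}
    (H : ∀ i j k, i ≠ j → i ≠ k → j ≠ k → 0 < dt (w i) (w j) (w k)) : False := by
  have ne : ∀ i j k, i ≠ j → i ≠ k → j ≠ k → dd (w i) (w j) (w k) ≠ 0 := by
    intro i j k hij hik hjk h0
    have x := H i j k hij hik hjk
    have y := H j i k hij.symm hjk hik
    have z := H k i j hik.symm hjk.symm hij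
    have e : dt (w i) (w j) (w k) ^ 2 + dd (w i) (w j) (w k) ^ 2
      = dt (w i) (w j) (w j) * dt (w i) (w k) (w k) := by unfold dt dd; ring
    have e1 : dt (w j) (w i) (w k) = dt (w i) (w j) (w j) - dt (w i) (w j) (w k) := by
      unfold dt; ring
    have e2 : dt (w k) (w i) (w j) = dt (w i) (w k) (w k) - dt (w i) (w j) (w k) := by
      unfold dt; ring
    rw [h0] at e
    nlinarith
  have n12 := ne 0 1 2 (by decide) (by decide) (by decide)
  have n23 := ne 0 2 3 (by decide) (by decide) (by decide)
  have n13 := ne 0 1 3 (by decide) (by decide) (by decide)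
  have a12 := dd_anti (w 0) (w 1) (w 2)
  have a23 := dd_anti (w 0) (w 2) (w 3)
  have a13 := dd_anti (w 0) (w 1) (w 3)
  rcases lt_or_gt_of_ne n12 with h12 | h12 <;> rcases lt_or_gt_of_ne n23 with h23 | h23
  · exact mid H 0 3 2 1 (by decide) (by decide) (by decide) (by decide) (by decide) (by decide)
      (by linarith) (by linarith)
  · rcases lt_or_gt_of_ne n13 with h13 | h13
    · exact mid H 0 2 3 1 (by decide) (by decide) (by decide) (by decide) (by decide) (by decide)
        (by linarith) (by linarith)
    · exact mid H 0 2 1 3 (by decide) (by decide) (by decide) (by decide) (by decide) (by decide)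
        (by linarith) (by linarith)
  · rcases lt_or_gt_of_ne n13 with h13 | h13
    · exact mid H 0 3 1 2 (by decide) (by decide) (by decide) (by decide) (by decide) (by decide)
        (by linarith) (by linarith)
    · exact mid H 0 1 3 2 (by decide) (by decide) (by decide) (by decide) (by decide) (by decide)
        (by linarith) (by linarith)
  · exact mid H 0 1 2 3 (by decide) (by decide) (by decide) (by decide) (by decide) (by decide)
      (by linarith) (by linarith)

theorem coreFalse (p : Fin 4 → Fin 2 → Pt) (w : Fin 4 → Pt)
    (H1 : ∀ k, dt (w k) (p k 0) (p k 1) ≤ 0)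
    (H2 : ∀ k l m i j, l ≠ m → 0 < dt (w k) (p l i) (p m j))
    (E : ∀ k l i, l ≠ k → 0 < dd (p k 0) (p k 1) (p l i)) : False := by
  have key : ∀ a b z, a ≠ b → 0 < dt (w a) (p b 0) z → 0 < dt (w a) (p b 1) z →
      0 < dt (w a) (w b) z := by
    intro a b z hab h1 h2
    refine inCone ?_ (H1 b) ?_ h1 h2
    · exact wedge (H1 a) (H2 _ _ _ _ _ hab) (H2 _ _ _ _ _ hab) (H2 _ _ _ _ _ hab)
        (H2 _ _ _ _ _ hab)
    · intro side
      exact noSide (H1 a) (H1 b) (H2 _ _ _ _ _ hab) (H2 _ _ _ _ _ hab) (H2 _ _ _ _ _ hab)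
        (H2 _ _ _ _ _ hab) (H2 _ _ _ _ _ hab.symm) (H2 _ _ _ _ _ hab.symm)
        (H2 _ _ _ _ _ hab.symm) (H2 _ _ _ _ _ hab.symm) (E _ _ _ hab.symm) (E _ _ _ hab.symm)
        (E _ _ _ hab) (E _ _ _ hab) side
  refine four (w := w) ?_
  intro i j k hij hik hjk
  have t : ∀ r, 0 < dt (w i) (p j r) (w k) := by
    intro r
    rw [dt_comm]
    exact key i k _ hik (H2 _ _ _ _ _ hjk.symm) (H2 _ _ _ _ _ hjk.symm)
  exact key i j _ hij (t 0) (t 1)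

theorem mem_disk (a b w : Pt) : w ∈ diskD a b ↔ dt w a b ≤ 0 := by
  unfold diskD
  rw [Metric.mem_closedBall, EuclideanSpace.dist_eq, EuclideanSpace.dist_eq,
    Real.sqrt_le_left (by positivity), div_pow, Real.sq_sqrt (by positivity)]
  simp only [Fin.sum_univ_two, Real.dist_eq, sq_abs, midpoint_eq_smul_add]
  simp only [PiLp.smul_apply, PiLp.add_apply, smul_eq_mul]
  unfold dt
  norm_num
  constructor <;> intro h <;> nlinarith

theorem notHull {n a b x : Pt} (h1 : 0 < dd n a b) (h2 : 0 < dd n b x) (h4 : 0 < dd n a x)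
    (h : dt n a b ≤ 0) (h3 : 0 < dt n a x) : False := by
  have e : dd n a x * dt n a b = dd n b x * dt n a a + dd n a b * dt n a x := by
    unfold dt dd; ring
  have p := dt_self_pos h3
  nlinarith [mul_pos h2 p, mul_pos h1 h3]

theorem notHull' {n a b x : Pt} (h1 : 0 < dd n a b) (h2 : 0 < dd n x a) (h4 : 0 < dd n x b)
    (h : dt n a b ≤ 0) (h3 : 0 < dt n b x) : False := by
  have e : dd n x b * dt n a b = dd n x a * dt n b b + dd n a b * dt n b x := by
    unfold dt dd; ring
  have p := dt_self_pos h3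
  nlinarith [mul_pos h2 p, mul_pos h1 h3]

theorem det2_dd (a b c : Pt) : det2 (b - a) (c - a) = dd a b c := by
  simp [det2, dd]

theorem dd_cyc (a b c : Pt) : dd a b c = dd b c a := by unfold dd; ring

/-- index of the `i`-th vertex of the `k`-th pair -/
def idx (k : Fin 4) (i : Fin 2) : Fin 8 := ⟨2 * k + i, by omega⟩

/-- There is no witness Gabriel drawing of `K_{2,2,2,2}` in which all the
vertices of the same color are consecutive on the convex hull. -/
theorem no_K2222_drawing_with_consecutive_colors :
    ¬ ∃ (P W : Finset Pt) (c : Pt → Fin 4) (q : Fin 8 → Pt),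
        (∀ i : Fin 4, (P.filter (fun p => c p = i)).card = 2) ∧
        GenPos ((P : Set Pt) ∪ (W : Set Pt)) ∧
        (∀ a ∈ P, ∀ b ∈ P, a ≠ b →
          (gabrielEdge (W : Set Pt) a b ↔ c a ≠ c b)) ∧
        Function.Injective q ∧ Set.range q = (P : Set Pt) ∧
        CCWConvexPos q ∧
        c (q 0) = c (q 1) ∧ c (q 2) = c (q 3) ∧
        c (q 4) = c (q 5) ∧ c (q 6) = c (q 7) := by
  classical
  rintro ⟨P, W, c, q, hcard, -, hadj, hinj, hrange, hccw, c0, c1, c2, c3⟩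
  have hP : ∀ i, q i ∈ P := by
    intro i
    have : q i ∈ (P : Set Pt) := hrange ▸ Set.mem_range_self i
    simpa using this
  have hcc : ∀ i j k : Fin 8, i < j → j < k → 0 < dd (q i) (q j) (q k) := by
    intro i j k hij hjk
    rw [← det2_dd]; exact hccw i j k hij hjk
  have same : ∀ k, c (q (idx k 0)) = c (q (idx k 1)) := by
    intro k; fin_cases k
    · exact c0
    · exact c1
    · exact c2
    · exact c3
  have same' : ∀ k i, c (q (idx k i)) = c (q (idx k 0)) := by
    intro k i; fin_cases i
    · rfl
    · exact (same k).symm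
  have idxne : ∀ k l i j, k ≠ l → idx k i ≠ idx l j := by decide
  have idxne' : ∀ k, idx k 0 ≠ idx k 1 := by decide
  have diff : ∀ k l i j, k ≠ l → c (q (idx k i)) ≠ c (q (idx l j)) := by
    intro k l i j hkl h
    rw [same' k, same' l] at h
    have hsub : ({q (idx k 0), q (idx k 1), q (idx l 0)} : Finset Pt) ⊆
        P.filter (fun p => c p = c (q (idx k 0))) := by
      intro x hx
      simp only [Finset.mem_insert, Finset.mem_singleton] at hx
      rw [Finset.mem_filter]
      rcases hx with rfl | rfl | rfl
      · exact ⟨hP _, rfl⟩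
      · exact ⟨hP _, (same k).symm⟩
      · exact ⟨hP _, h.symm⟩
    have h3 : ({q (idx k 0), q (idx k 1), q (idx l 0)} : Finset Pt).card = 3 := by
      rw [Finset.card_eq_three]
      exact ⟨_, _, _, hinj.ne (idxne' k), hinj.ne (idxne _ _ _ _ hkl),
        hinj.ne (idxne _ _ _ _ hkl), rfl⟩
    have := Finset.card_le_card hsub
    rw [h3, hcard] at this
    omega
  have wit : ∀ k, ∃ w ∈ W, w ≠ q (idx k 0) ∧ w ≠ q (idx k 1) ∧
      dt w (q (idx k 0)) (q (idx k 1)) ≤ 0 := by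
    intro k
    have h := (hadj _ (hP (idx k 0)) _ (hP (idx k 1)) (hinj.ne (idxne' k))).not.2
      (not_not.2 (same k))
    unfold gabrielEdge at h
    obtain ⟨w, ⟨hw1, hw2⟩, hw3⟩ := Set.nonempty_iff_ne_empty.2 h
    simp only [Set.mem_insert_iff, Set.mem_singleton_iff, not_or] at hw2
    exact ⟨w, by simpa using hw3, hw2.1, hw2.2, (mem_disk _ _ _).1 hw1⟩
  have acute : ∀ w ∈ W, ∀ l m i j, l ≠ m → w ≠ q (idx l i) → w ≠ q (idx m j) →
      0 < dt w (q (idx l i)) (q (idx m j)) := by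
    intro w hw l m i j hlm h1 h2
    have h := (hadj _ (hP (idx l i)) _ (hP (idx m j)) (hinj.ne (idxne _ _ _ _ hlm))).2
      (diff _ _ _ _ hlm)
    unfold gabrielEdge at h
    by_contra hn
    push Not at hn
    have : w ∈ (diskD (q (idx l i)) (q (idx m j)) \ {q (idx l i), q (idx m j)}) ∩ (W : Set Pt) := by
      refine ⟨⟨(mem_disk _ _ _).2 hn, ?_⟩, by simpa using hw⟩
      simp [h1, h2]
    rw [h] at this
    exact this
  choose w hwW hw0 hw1 hwd using wit
  have E : ∀ k l i, l ≠ k → 0 < dd (q (idx k 0)) (q (idx k 1)) (q (idx l i)) := by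
    intro k l i hlk
    rcases lt_or_gt_of_ne hlk with h | h
    · rw [← dd_cyc]
      apply hcc <;> simp only [idx, Fin.lt_def] at * <;> simp <;> omega
    · apply hcc <;> simp only [idx, Fin.lt_def] at * <;> simp <;> omega
  have hull : ∀ n k l m i, l ≠ k → m ≠ k → m ≠ l → n = idx l i →
      (0 < dd (q n) (q (idx k 1)) (q (idx m 0)) ∧ 0 < dd (q n) (q (idx k 0)) (q (idx m 0))) ∨
      (0 < dd (q n) (q (idx m 0)) (q (idx k 0)) ∧ 0 < dd (q n) (q (idx m 0)) (q (idx k 1))) := by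
    have pos : ∀ i j k : Fin 8, (i < j ∧ j < k) ∨ (j < k ∧ k < i) ∨ (k < i ∧ i < j) →
        0 < dd (q i) (q j) (q k) := by
      rintro i j k (⟨h, h'⟩ | ⟨h, h'⟩ | ⟨h, h'⟩)
      · exact hcc _ _ _ h h'
      · rw [dd_cyc]; exact hcc _ _ _ h h'
      · rw [← dd_cyc]; exact hcc _ _ _ h h'
    have dec : ∀ n k l m i, l ≠ k → m ≠ k → m ≠ l → n = idx l i →
      ((((n < idx k 1 ∧ idx k 1 < idx m 0) ∨ (idx k 1 < idx m 0 ∧ idx m 0 < n) ∨ (idx m 0 < n ∧ n < idx k 1))) ∧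
       (((n < idx k 0 ∧ idx k 0 < idx m 0) ∨ (idx k 0 < idx m 0 ∧ idx m 0 < n) ∨ (idx m 0 < n ∧ n < idx k 0)))) ∨
      ((((n < idx m 0 ∧ idx m 0 < idx k 0) ∨ (idx m 0 < idx k 0 ∧ idx k 0 < n) ∨ (idx k 0 < n ∧ n < idx m 0))) ∧
       (((n < idx m 0 ∧ idx m 0 < idx k 1) ∨ (idx m 0 < idx k 1 ∧ idx k 1 < n) ∨ (idx k 1 < n ∧ n < idx m 0)))) := by
      intro n k l m i h1 h2 h3 h4
      subst h4
      simp only [idx, Fin.lt_def, ne_eq, Fin.ext_iff] at *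
      simp
      omega
    intro n k l m i h1 h2 h3 h4
    rcases dec n k l m i h1 h2 h3 h4 with ⟨x, y⟩ | ⟨x, y⟩
    · exact Or.inl ⟨pos _ _ _ x, pos _ _ _ y⟩
    · exact Or.inr ⟨pos _ _ _ x, pos _ _ _ y⟩
  have wne : ∀ k l i, w k ≠ q (idx l i) := by
    intro k l i he
    by_cases hlk : l = k
    · subst hlk
      fin_cases i
      · exact hw0 _ he
      · exact hw1 _ he
    · obtain ⟨m, hmk, hml⟩ : ∃ m : Fin 4, m ≠ k ∧ m ≠ l := by
        have : ∀ k l : Fin 4, ∃ m : Fin 4, m ≠ k ∧ m ≠ l := by decide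
        exact this k l
      have d := hwd k
      have hnm : w k ≠ q (idx m 0) := by rw [he]; exact hinj.ne (idxne _ _ _ _ hml.symm)
      have A0 := acute (w k) (hwW k) k m 0 0 hmk.symm (hw0 k) hnm
      have A1 := acute (w k) (hwW k) k m 1 0 hmk.symm (hw1 k) hnm
      have e := E k l i hlk
      rw [← dd_cyc] at e
      rw [he] at d A0 A1
      rcases hull _ k l m i hlk hmk hml rfl with ⟨x, y⟩ | ⟨x, y⟩
      · exact notHull e x y d A0
      · exact notHull' e x y d A1
  exact coreFalse (fun k i => q (idx k i)) w hwd
    (fun k l m i j hlm => acute (w k) (hwW k) l m i j hlm (wne _ _ _) (wne _ _ _)) E
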